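/- arXiv:1906.05174 — 6 statements merged into one kernel-verified Lean document; each statement's English description precedes it below -/
import Mathlib

section
/- Let n, m be positive natural numbers, let H ∈ ℂ^{n×m} be a complex matrix, let c > 0 be a real number, and set K = min(n, m). Then log₂ det(I_m + c·HᴴH) ≤ K · log₂(1 + (c/K) · tr(HHᴴ)), where det(I_m + c·HᴴH) and tr(HHᴴ) are real (the first matrix is positive definite Hermitian and the second is positive semidefinite Hermitian). -/
open scoped ComplexOrder in
theorem aux_log_det_le {k : ℕ} (hk : 0 < k) (P : Matrix (Fin k) (Fin k) ℂ) (hP : P.PosDef) :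
    Real.log (P.det).re ≤ (k : ℝ) * Real.log ((P.trace).re / k) := by
  have hk' : (0 : ℝ) < k := by exact_mod_cast hk
  have hdet : (P.det).re = ∏ i, hP.isHermitian.eigenvalues i := by
    rw [hP.isHermitian.det_eq_prod_eigenvalues]
    rw [← RCLike.ofReal_prod]
    exact Complex.ofReal_re _
  have htr : (P.trace).re = ∑ i, hP.isHermitian.eigenvalues i := by
    rw [hP.isHermitian.trace_eq_sum_eigenvalues]
    rw [← RCLike.ofReal_sum]
    exact Complex.ofReal_re _
  have hpos : ∀ i, 0 < hP.isHermitian.eigenvalues i := hP.eigenvalues_pos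
  rw [hdet, htr, Real.log_prod (fun i _ => (hpos i).ne')]
  generalize hP.isHermitian.eigenvalues = l at hpos
  have hs : 0 < ∑ i, l i :=
    Finset.sum_pos (fun i _ => hpos i) ⟨⟨0, hk⟩, Finset.mem_univ _⟩
  set t := (∑ i, l i) / k with ht
  have htp : 0 < t := div_pos hs hk'
  calc ∑ i, Real.log (l i) ≤ ∑ i, (l i / t - 1 + Real.log t) := by
        refine Finset.sum_le_sum fun i _ => ?_
        have := Real.log_le_sub_one_of_pos (div_pos (hpos i) htp)
        rw [Real.log_div (hpos i).ne' htp.ne'] at this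
        linarith
    _ = (k : ℝ) * Real.log t := by
        rw [Finset.sum_add_distrib, Finset.sum_sub_distrib, ← Finset.sum_div]
        have : (∑ i, l i) / t = k := by
          rw [ht]; field_simp
        rw [this]; simp

open scoped ComplexOrder in
theorem aux_cap {k j : ℕ} (hk : 0 < k) (G : Matrix (Fin j) (Fin k) ℂ) (c : ℝ) (hc : 0 < c) :
    Real.logb 2 ((1 + (c : ℂ) • (G.conjTranspose * G)).det).re ≤
      (k : ℝ) * Real.logb 2 (1 + c / (k : ℝ) * ((G * G.conjTranspose).trace).re) := by
  have hk' : (0 : ℝ) < k := by exact_mod_cast hk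
  have hP : (1 + (c : ℂ) • (G.conjTranspose * G)).PosDef := by
    refine Matrix.PosDef.one.add_posSemidef ?_
    exact (Matrix.posSemidef_conjTranspose_mul_self G).smul (by exact_mod_cast hc.le)
  have h := aux_log_det_le hk _ hP
  have e : ((1 + (c : ℂ) • (G.conjTranspose * G)).trace).re / k
      = 1 + c / (k : ℝ) * ((G * G.conjTranspose).trace).re := by
    rw [Matrix.trace_mul_comm G, Matrix.trace_add, Matrix.trace_smul]
    simp
    field_simp
  rw [e] at h
  simp only [Real.logb]
  rw [← mul_div_assoc]
  exact div_le_div_of_nonneg_right h (Real.log_nonneg (by norm_num))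

open Matrix

/-- For `H : ℂ^{n×m}`, `c > 0`, `K = min n m`:
`log₂ det(I + c·HᴴH) ≤ K · log₂(1 + (c/K)·tr(HHᴴ))`. -/
theorem capacity_upper_bound_generic (n m : ℕ) (hn : 0 < n) (hm : 0 < m)
    (H : Matrix (Fin n) (Fin m) ℂ) (c : ℝ) (hc : 0 < c) :
    Real.logb 2 ((1 + (c : ℂ) • (Hᴴ * H)).det).re ≤
      (min n m : ℝ) *
        Real.logb 2 (1 + c / (min n m : ℝ) * ((H * Hᴴ).trace).re) := by
  rcases le_total m n with h | h
  · rw [min_eq_right (by exact_mod_cast h : (m : ℝ) ≤ n)]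
    exact aux_cap hm H c hc
  · rw [min_eq_left (by exact_mod_cast h : (n : ℝ) ≤ m)]
    have := aux_cap hn Hᴴ c hc
    rw [conjTranspose_conjTranspose] at this
    rw [← Matrix.smul_mul, Matrix.det_one_add_mul_comm, Matrix.mul_smul, Matrix.trace_mul_comm]
    exact this
end

section
/- Let N_T, N_R, N_U be positive natural numbers, H₁ ∈ ℂ^{N_U×N_T}, H₂ ∈ ℂ^{N_R×N_U} complex matrices, f ≥ 0 and c > 0 real numbers, and K = min(N_T, N_R, N_U). Then the matrix f·H₂H₂ᴴ + I_{N_R} is positive definite (hence invertible) and log₂ det(I_{N_T} + c·H₁ᴴH₂ᴴ(f·H₂H₂ᴴ + I_{N_R})⁻¹H₂H₁) ≤ K · log₂(1 + (c/K) · tr((f·H₂H₂ᴴ + I_{N_R})⁻¹H₂H₁H₁ᴴH₂ᴴ)). -/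
open Matrix ComplexOrder

lemma log_sum_aux {ι : Type*} [Fintype ι] (l : ι → ℝ) (hl : ∀ i, 0 ≤ l i) (K : ℝ) (hK : 0 < K)
    (hr : (Fintype.card {i // l i ≠ 0} : ℝ) ≤ K) :
    Real.log (∏ i, (1 + l i)) ≤ K * Real.log (1 + (∑ i, l i) / K) := by
  classical
  set t : ℝ := (∑ i, l i) / K with ht
  have hS : ∑ i, l i = K * t := by rw [ht]; field_simp
  have ht0 : 0 ≤ t := div_nonneg (Finset.sum_nonneg fun i _ => hl i) hK.le
  have h1t : 0 < 1 + t := by linarith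
  rw [Real.log_prod (fun i _ => by have := hl i; positivity)]
  set L := Real.log (1 + t) with hL
  have hLt : t / (1 + t) ≤ L := by
    have := Real.one_sub_inv_le_log_of_pos h1t
    have e : t / (1 + t) = 1 - (1 + t)⁻¹ := by field_simp; ring
    rw [e]; exact this
  have key : ∀ i, Real.log (1 + l i) ≤
      (if l i ≠ 0 then (L - t / (1 + t)) else 0) + l i / (1 + t) := by
    intro i
    have hi := hl i
    split_ifs with h
    · have h1 := Real.log_le_sub_one_of_pos (show 0 < (1 + l i) / (1 + t) by positivity)
      rw [Real.log_div (by positivity) (by positivity)] at h1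
      have e : (1 + l i) / (1 + t) - 1 = l i / (1 + t) - t / (1 + t) := by field_simp; ring
      linarith
    · have h : l i = 0 := by simpa using h
      simp [h]
  refine (Finset.sum_le_sum fun i _ => key i).trans ?_
  rw [Finset.sum_add_distrib, ← Finset.sum_div, hS, ← Finset.sum_filter, Finset.sum_const,
    nsmul_eq_mul, ← Fintype.card_subtype]
  have := mul_le_mul_of_nonneg_right hr (sub_nonneg.2 hLt)
  have e : K * t / (1 + t) = K * (t / (1 + t)) := by ring
  rw [e]
  linarith

lemma det_one_add_aux {n : Type*} [Fintype n] [DecidableEq n] (B : Matrix n n ℂ)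
    (hB : B.IsHermitian) : (1 + B).det = ((∏ i, (1 + hB.eigenvalues i) : ℝ) : ℂ) := by
  have h := congrArg (Polynomial.eval (-1 : ℂ)) hB.charpoly_eq
  rw [Matrix.eval_charpoly, Polynomial.eval_prod] at h
  have e : Matrix.scalar n (-1 : ℂ) - B = -(1 + B) := by
    rw [map_neg, map_one]; abel
  rw [e, Matrix.det_neg] at h
  have e2 : ∀ i, Polynomial.eval (-1 : ℂ) (Polynomial.X - Polynomial.C (hB.eigenvalues i : ℂ))
      = (-1) * (1 + (hB.eigenvalues i : ℂ)) := by
    intro i; simp; ring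
  have h2 : (-1 : ℂ) ^ Fintype.card n * (1 + B).det
      = (-1) ^ Fintype.card n * ∏ i, (1 + (hB.eigenvalues i : ℂ)) := by
    refine h.trans ((Finset.prod_congr rfl fun i _ => e2 i).trans ?_)
    rw [Finset.prod_mul_distrib, Finset.prod_const, Finset.card_univ]
  have h3 := mul_left_cancel₀ (pow_ne_zero _ (by norm_num)) h2
  rw [h3]; push_cast; rfl

lemma logdet_aux {n : Type*} [Fintype n] [DecidableEq n] (B : Matrix n n ℂ)
    (hB : B.PosSemidef) (K : ℝ) (hK : 0 < K) (hr : (B.rank : ℝ) ≤ K) :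
    Real.log ((1 + B).det).re ≤ K * Real.log (1 + B.trace.re / K) := by
  have hH := hB.isHermitian
  rw [det_one_add_aux B hH, Complex.ofReal_re, hH.trace_eq_sum_eigenvalues]
  rw [hH.rank_eq_card_non_zero_eigs] at hr
  have := log_sum_aux hH.eigenvalues hB.eigenvalues_nonneg K hK hr
  simpa using this

/-- Theorem 1 of the paper: the noise covariance `f·H₂H₂ᴴ + I` is
positive definite, and the end-to-end AF-MIMO-relay capacity
`log₂ det(I + c·H₁ᴴH₂ᴴ(f·H₂H₂ᴴ + I)⁻¹H₂H₁)` is at most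
`K·log₂(1 + (c/K)·tr((f·H₂H₂ᴴ + I)⁻¹H₂H₁H₁ᴴH₂ᴴ))` with `K = min(N_T, N_R, N_U)`. -/
theorem relay_capacity_upper_bound (NT NR NU : ℕ)
    (hT : 0 < NT) (hR : 0 < NR) (hU : 0 < NU)
    (H₁ : Matrix (Fin NU) (Fin NT) ℂ) (H₂ : Matrix (Fin NR) (Fin NU) ℂ)
    (f c : ℝ) (hf : 0 ≤ f) (hc : 0 < c) :
    ((f : ℂ) • (H₂ * H₂ᴴ) + 1).PosDef ∧
    Real.logb 2
        ((1 + (c : ℂ) •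
          (H₁ᴴ * H₂ᴴ * ((f : ℂ) • (H₂ * H₂ᴴ) + 1)⁻¹ * H₂ * H₁)).det).re ≤
      (min NT (min NR NU) : ℝ) *
        Real.logb 2 (1 + c / (min NT (min NR NU) : ℝ) *
          ((((f : ℂ) • (H₂ * H₂ᴴ) + 1)⁻¹ * H₂ * H₁ * H₁ᴴ * H₂ᴴ).trace).re) := by
  have hP : ((f : ℂ) • (H₂ * H₂ᴴ) + 1).PosDef := by
    refine Matrix.PosDef.posSemidef_add ?_ Matrix.PosDef.one
    exact (Matrix.posSemidef_self_mul_conjTranspose H₂).smul (by exact_mod_cast hf)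
  refine ⟨hP, ?_⟩
  set P := (f : ℂ) • (H₂ * H₂ᴴ) + 1 with hPdef
  set A := H₁ᴴ * H₂ᴴ * P⁻¹ * H₂ * H₁ with hA
  have hApsd : A.PosSemidef := by
    have := hP.inv.posSemidef.conjTranspose_mul_mul_same (H₂ * H₁)
    rw [Matrix.conjTranspose_mul] at this
    simpa [hA, Matrix.mul_assoc] using this
  have htr : (P⁻¹ * H₂ * H₁ * H₁ᴴ * H₂ᴴ).trace = A.trace := by
    have e1 : P⁻¹ * H₂ * H₁ * H₁ᴴ * H₂ᴴ = (P⁻¹ * H₂ * H₁) * (H₁ᴴ * H₂ᴴ) := by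
      simp only [Matrix.mul_assoc]
    have e2 : A = (H₁ᴴ * H₂ᴴ) * (P⁻¹ * H₂ * H₁) := by
      simp only [hA, Matrix.mul_assoc]
    rw [e1, e2, Matrix.trace_mul_comm]
  have hrank : ((c : ℂ) • A).rank ≤ min NT (min NR NU) := by
    have h1 : ((c : ℂ) • A).rank ≤ NT := by simpa using Matrix.rank_le_width ((c : ℂ) • A)
    have h2 : ((c : ℂ) • A) = ((c : ℂ) • (H₁ᴴ * H₂ᴴ * P⁻¹)) * (H₂ * H₁) := by
      simp only [hA, Matrix.mul_assoc, Matrix.smul_mul]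
    have h3 : ((c : ℂ) • A).rank ≤ H₂.rank := by
      rw [h2]
      exact (Matrix.rank_mul_le_right _ _).trans (Matrix.rank_mul_le_left _ _)
    exact le_min h1 (le_min (h3.trans (Matrix.rank_le_height H₂))
      (h3.trans (Matrix.rank_le_width H₂)))
  have hK : 0 < (min NT (min NR NU) : ℝ) := by
    have : 0 < min NT (min NR NU) := by simp [hT, hR, hU]
    exact_mod_cast this
  have hrank' : (((c : ℂ) • A).rank : ℝ) ≤ (min NT (min NR NU) : ℝ) := by exact_mod_cast hrank
  have main := logdet_aux ((c : ℂ) • A) (hApsd.smul (by exact_mod_cast hc.le)) _ hK hrank'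
  rw [htr]
  have et : (((c : ℂ) • A).trace).re / (min NT (min NR NU) : ℝ)
      = c / (min NT (min NR NU) : ℝ) * A.trace.re := by
    rw [Matrix.trace_smul, smul_eq_mul, Complex.re_ofReal_mul]; ring
  rw [et] at main
  unfold Real.logb
  rw [← mul_div_assoc]
  exact div_le_div_of_nonneg_right main (Real.log_nonneg (by norm_num))
end

section
/- Let K be a positive natural number and let S ∈ ℝ^{K×K} be a doubly stochastic matrix, i.e. all entries S_{ij} ≥ 0, every row sums to 1, and every column sums to 1. Let d, l : Fin K → ℝ be nonnegative and both nonincreasing (d₁ ≥ d₂ ≥ … ≥ d_K ≥ 0 and l₁ ≥ l₂ ≥ … ≥ l_K ≥ 0). Then Σᵢ Σⱼ dᵢ · lⱼ · S_{ij} ≤ Σᵢ dᵢ · lᵢ. -/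
open Finset

/-- if `S` is a `K×K` doubly stochastic matrix and
`d, l : Fin K → ℝ` are nonnegative and nonincreasing, then
`Σᵢ Σⱼ dᵢ·lⱼ·S_{ij} ≤ Σᵢ dᵢ·lᵢ`. -/
theorem doubly_stochastic_rearrangement (K : ℕ) (hK : 0 < K)
    (S : Matrix (Fin K) (Fin K) ℝ)
    (hS_nonneg : ∀ i j, 0 ≤ S i j)
    (hS_rows : ∀ i, ∑ j, S i j = 1)
    (hS_cols : ∀ j, ∑ i, S i j = 1)
    (d l : Fin K → ℝ)
    (hd_nonneg : ∀ i, 0 ≤ d i) (hl_nonneg : ∀ i, 0 ≤ l i)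
    (hd_mono : Antitone d) (hl_mono : Antitone l) :
    ∑ i, ∑ j, d i * l j * S i j ≤ ∑ i, d i * l i := by
  obtain ⟨w, hw0, hw1, hwS⟩ := exists_eq_sum_perm_of_mem_doublyStochastic
    (mem_doublyStochastic_iff_sum.2 ⟨hS_nonneg, hS_rows, hS_cols⟩)
  have hS : ∀ i j, S i j = ∑ σ : Equiv.Perm (Fin K), w σ * (if σ i = j then 1 else 0) := by
    intro i j
    rw [← hwS, Matrix.sum_apply]
    refine Finset.sum_congr rfl fun σ _ => ?_
    simp [Equiv.Perm.permMatrix, PEquiv.toMatrix_apply, Equiv.toPEquiv_apply, eq_comm]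
  have key : ∑ i, ∑ j, d i * l j * S i j
      = ∑ σ : Equiv.Perm (Fin K), w σ * ∑ i, d i * l (σ i) := by
    simp_rw [hS, Finset.mul_sum]
    rw [Finset.sum_comm (s := (Finset.univ : Finset (Equiv.Perm (Fin K))))]
    refine Finset.sum_congr rfl fun i _ => ?_
    rw [Finset.sum_comm]
    refine Finset.sum_congr rfl fun σ _ => ?_
    simp [mul_comm]
  rw [key]
  calc _ ≤ ∑ σ : Equiv.Perm (Fin K), w σ * ∑ i, d i * l i :=
        Finset.sum_le_sum fun σ _ => mul_le_mul_of_nonneg_left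
          (hd_mono.monovary hl_mono).sum_mul_comp_perm_le_sum_mul (hw0 σ)
    _ = _ := by rw [← Finset.sum_mul, hw1, one_mul]
end

section
/- Let N_T, N_R, N_U be positive natural numbers, H₁ ∈ ℂ^{N_U×N_T}, H₂ ∈ ℂ^{N_R×N_U} complex matrices, and f ≥ 0 a real number. Let a : Fin N_U → ℝ be the eigenvalues of the positive semidefinite Hermitian matrix H₁H₁ᴴ arranged in nonincreasing order, and b : Fin N_U → ℝ the eigenvalues of H₂ᴴH₂ arranged in nonincreasing order (so aᵢ, bᵢ ≥ 0 are the squared singular values of H₁ and H₂ respectively). Then tr((f·H₂H₂ᴴ + I_{N_R})⁻¹H₂H₁H₁ᴴH₂ᴴ) ≤ Σ_{i ∈ Fin N_U} aᵢ · bᵢ / (1 + f·bᵢ). -/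
open Matrix

theorem aux_ds_sum {n : ℕ} (P : Matrix (Fin n) (Fin n) ℝ) (hP : P ∈ doublyStochastic ℝ (Fin n))
    (x y : Fin n → ℝ) (ρ τ : Equiv.Perm (Fin n)) (hx : Antitone (x ∘ ρ)) (hy : Antitone (y ∘ τ)) :
    ∑ i, ∑ j, x i * P i j * y j ≤ ∑ i, x (ρ i) * y (τ i) := by
  obtain ⟨w, hw0, hw1, rfl⟩ := exists_eq_sum_perm_of_mem_doublyStochastic hP
  have key : ∀ σ : Equiv.Perm (Fin n), ∑ i, x i * y (σ i) ≤ ∑ i, x (ρ i) * y (τ i) := by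
    intro σ
    have hm : Monovary (x ∘ ρ) (y ∘ τ) := hx.monovary hy
    have := hm.sum_mul_comp_perm_le_sum_mul (σ := ρ.trans (σ.trans τ.symm))
    rw [← Equiv.sum_comp ρ (fun i => x i * y (σ i))]
    simpa using this
  have e : ∑ i, ∑ j, x i * (∑ σ, w σ • σ.permMatrix ℝ) i j * y j
      = ∑ σ : Equiv.Perm (Fin n), w σ * ∑ i, x i * y (σ i) := by
    simp only [Matrix.sum_apply, Matrix.smul_apply, Finset.mul_sum, Finset.sum_mul]
    rw [Finset.sum_comm' (t' := Finset.univ) (s' := fun _ => Finset.univ) (by simp)]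
    rw [Finset.sum_congr rfl fun j _ => Finset.sum_comm]
    rw [Finset.sum_comm]
    refine Finset.sum_congr rfl fun σ _ => ?_
    rw [Finset.sum_comm]
    refine Finset.sum_congr rfl fun i _ => ?_
    rw [Finset.sum_eq_single (σ i)]
    · simp [Equiv.Perm.permMatrix, PEquiv.toMatrix_apply]; ring
    · intro j _ hj
      simp [Equiv.Perm.permMatrix, PEquiv.toMatrix_apply, hj.symm]
    · simp
  rw [e]
  calc _ ≤ ∑ σ, w σ * ∑ i, x (ρ i) * y (τ i) :=
        Finset.sum_le_sum fun σ _ => mul_le_mul_of_nonneg_left (key σ) (hw0 σ)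
    _ = _ := by rw [← Finset.sum_mul, hw1, one_mul]

theorem aux_unitary_ds {n : ℕ} (W : Matrix (Fin n) (Fin n) ℂ) (h1 : W * Wᴴ = 1) (h2 : Wᴴ * W = 1) :
    (Matrix.of fun i j => Complex.normSq (W i j)) ∈ doublyStochastic ℝ (Fin n) := by
  rw [mem_doublyStochastic_iff_sum]
  refine ⟨fun i j => Complex.normSq_nonneg _, fun i => ?_, fun j => ?_⟩
  · have := congrFun (congrFun h1 i) i
    simp only [Matrix.mul_apply, conjTranspose_apply, one_apply_eq, Complex.star_def,
      Complex.mul_conj] at this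
    exact_mod_cast this
  · have := congrFun (congrFun h2 j) j
    simp only [Matrix.mul_apply, conjTranspose_apply, one_apply_eq, Complex.star_def,
      mul_comm (starRingEnd ℂ _), Complex.mul_conj] at this
    exact_mod_cast this

theorem aux_trace {n : ℕ} (W : Matrix (Fin n) (Fin n) ℂ) (c a : Fin n → ℝ) :
    ((diagonal (fun i => (c i : ℂ)) * W * diagonal (fun i => (a i : ℂ)) * Wᴴ).trace).re
      = ∑ i, ∑ j, c i * Complex.normSq (W i j) * a j := by
  have : (diagonal (fun i => (c i : ℂ)) * W * diagonal (fun i => (a i : ℂ)) * Wᴴ).trace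
      = ((∑ i, ∑ j, c i * Complex.normSq (W i j) * a j : ℝ) : ℂ) := by
    simp only [trace, diag_apply]
    push_cast
    refine Finset.sum_congr rfl fun i _ => ?_
    rw [Matrix.mul_apply]
    refine Finset.sum_congr rfl fun j _ => ?_
    rw [mul_diagonal, diagonal_mul, conjTranspose_apply, ← Complex.mul_conj, Complex.star_def]
    ring
  rw [this, Complex.ofReal_re]



/-- inequality (12) in the proof of Theorem 2: with
`a : Fin N_U → ℝ` the eigenvalues of `H₁H₁ᴴ` and `b : Fin N_U → ℝ` the
eigenvalues of `H₂ᴴH₂`, each arranged in nonincreasing order,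
`tr((f·H₂H₂ᴴ + I)⁻¹H₂H₁H₁ᴴH₂ᴴ) ≤ Σᵢ aᵢ·bᵢ/(1 + f·bᵢ)`. -/
theorem whitened_trace_upper_bound (NT NR NU : ℕ)
    (hT : 0 < NT) (hR : 0 < NR) (hU : 0 < NU)
    (H₁ : Matrix (Fin NU) (Fin NT) ℂ) (H₂ : Matrix (Fin NR) (Fin NU) ℂ)
    (f : ℝ) (hf : 0 ≤ f)
    (h1 : (H₁ * H₁ᴴ).IsHermitian) (h2 : (H₂ᴴ * H₂).IsHermitian)
    (a b : Fin NU → ℝ) (ha_mono : Antitone a) (hb_mono : Antitone b)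
    (ha : ∃ σ : Equiv.Perm (Fin NU), a = h1.eigenvalues ∘ σ)
    (hb : ∃ σ : Equiv.Perm (Fin NU), b = h2.eigenvalues ∘ σ) :
    ((((f : ℂ) • (H₂ * H₂ᴴ) + 1)⁻¹ * H₂ * H₁ * H₁ᴴ * H₂ᴴ).trace).re ≤
      ∑ i, a i * b i / (1 + f * b i) := by
  obtain ⟨ρ, rfl⟩ := ha
  obtain ⟨τ, rfl⟩ := hb
  have hbn : ∀ i, 0 ≤ h2.eigenvalues i := by
    open scoped ComplexOrder in
    exact (Matrix.posSemidef_conjTranspose_mul_self H₂).eigenvalues_nonneg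
  have hpos : ∀ i, 0 < 1 + f * h2.eigenvalues i := fun i => by
    have := mul_nonneg hf (hbn i); linarith
  have sa := h1.spectral_theorem
  have sb := h2.spectral_theorem
  rw [Unitary.conjStarAlgAut_apply] at sa sb
  have hU1 : (h1.eigenvectorUnitary : Matrix (Fin NU) (Fin NU) ℂ)ᴴ * (h1.eigenvectorUnitary : Matrix (Fin NU) (Fin NU) ℂ) = 1 :=
    Unitary.coe_star_mul_self _
  have hU2 : (h1.eigenvectorUnitary : Matrix (Fin NU) (Fin NU) ℂ) * (h1.eigenvectorUnitary : Matrix (Fin NU) (Fin NU) ℂ)ᴴ = 1 :=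
    Unitary.coe_mul_star_self _
  have hV1 : (h2.eigenvectorUnitary : Matrix (Fin NU) (Fin NU) ℂ)ᴴ * (h2.eigenvectorUnitary : Matrix (Fin NU) (Fin NU) ℂ) = 1 :=
    Unitary.coe_star_mul_self _
  have hV2 : (h2.eigenvectorUnitary : Matrix (Fin NU) (Fin NU) ℂ) * (h2.eigenvectorUnitary : Matrix (Fin NU) (Fin NU) ℂ)ᴴ = 1 :=
    Unitary.coe_mul_star_self _
  rw [star_eq_conjTranspose] at sa sb
  generalize (h1.eigenvectorUnitary : Matrix (Fin NU) (Fin NU) ℂ) = U at *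
  generalize (h2.eigenvectorUnitary : Matrix (Fin NU) (Fin NU) ℂ) = V at *
  generalize h1.eigenvalues = α at *
  generalize h2.eigenvalues = β at *
  have hpc : ∀ i, (1 + (f : ℂ) * β i) ≠ 0 := fun i => by exact_mod_cast (hpos i).ne'
  set E : Matrix (Fin NU) (Fin NU) ℂ := V * diagonal (fun i => (1 + (f : ℂ) * β i)⁻¹) * Vᴴ with hE
  have canc : ∀ X Y : Matrix (Fin NU) (Fin NU) ℂ, (V * X * Vᴴ) * (V * Y * Vᴴ) = V * (X * Y) * Vᴴ := by
    intro X Y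
    calc _ = V * X * (Vᴴ * V) * Y * Vᴴ := by simp only [Matrix.mul_assoc]
      _ = _ := by rw [hV1]; simp only [Matrix.mul_assoc, Matrix.one_mul]
  have hN : (f : ℂ) • (H₂ᴴ * H₂) + 1 = V * diagonal (fun i => 1 + (f : ℂ) * β i) * Vᴴ := by
    have : diagonal (fun i => 1 + (f : ℂ) * β i)
        = (f : ℂ) • diagonal ((RCLike.ofReal : ℝ → ℂ) ∘ β) + 1 := by
      ext i j
      by_cases hij : i = j
      · subst hij; simp [add_comm]
      · simp [hij]
    rw [this, Matrix.mul_add, Matrix.add_mul, sb]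
    simp [hV2]
  have hNE : ((f : ℂ) • (H₂ᴴ * H₂) + 1) * E = 1 := by
    rw [hN, hE, canc, diagonal_mul_diagonal]
    simp [hpc, hV2]
  have hBE : (H₂ᴴ * H₂) * E = V * diagonal (fun i => ((β i / (1 + f * β i) : ℝ) : ℂ)) * Vᴴ := by
    rw [sb, hE, canc, diagonal_mul_diagonal]
    congr 3
    ext i
    simp [div_eq_mul_inv]
  have hM : IsUnit ((f : ℂ) • (H₂ * H₂ᴴ) + 1) := by
    open scoped ComplexOrder in
    exact (Matrix.PosDef.posSemidef_add ((Matrix.posSemidef_self_mul_conjTranspose H₂).smul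
      (show (0 : ℂ) ≤ (f : ℂ) by exact_mod_cast hf)) Matrix.PosDef.one).isUnit
  have hMH : ((f : ℂ) • (H₂ * H₂ᴴ) + 1)⁻¹ * H₂ = H₂ * E := by
    have h : ((f : ℂ) • (H₂ * H₂ᴴ) + 1) * (H₂ * E) = H₂ := by
      calc _ = H₂ * (((f : ℂ) • (H₂ᴴ * H₂) + 1) * E) := by
            simp only [Matrix.add_mul, Matrix.mul_add, Matrix.smul_mul, Matrix.mul_smul,
              Matrix.mul_assoc, Matrix.one_mul]
        _ = H₂ := by rw [hNE, Matrix.mul_one]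
    have h' := congrArg (fun X => ((f : ℂ) • (H₂ * H₂ᴴ) + 1)⁻¹ * X) h
    rw [← h', ← Matrix.mul_assoc, Matrix.nonsing_inv_mul _ ((Matrix.isUnit_iff_isUnit_det _).1 hM),
      Matrix.one_mul]
  have htr : (((f : ℂ) • (H₂ * H₂ᴴ) + 1)⁻¹ * H₂ * H₁ * H₁ᴴ * H₂ᴴ).trace
      = (diagonal (fun i => ((β i / (1 + f * β i) : ℝ) : ℂ)) * (Vᴴ * U)
          * diagonal (fun i => (α i : ℂ)) * (Vᴴ * U)ᴴ).trace := by
    rw [hMH, Matrix.trace_mul_comm]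
    calc _ = (((H₂ᴴ * H₂) * E) * (H₁ * H₁ᴴ)).trace := by simp only [Matrix.mul_assoc]
      _ = (V * (diagonal (fun i => ((β i / (1 + f * β i) : ℝ) : ℂ)) * Vᴴ
            * (U * diagonal (fun i => (α i : ℂ)) * Uᴴ))).trace := by
          rw [hBE, sa]; simp only [Matrix.mul_assoc]; rfl
      _ = _ := by
          rw [Matrix.trace_mul_comm]
          simp only [Matrix.mul_assoc, conjTranspose_mul, conjTranspose_conjTranspose]
  rw [htr, aux_trace]
  have hW1 : (Vᴴ * U) * (Vᴴ * U)ᴴ = 1 := by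
    rw [conjTranspose_mul, conjTranspose_conjTranspose, Matrix.mul_assoc, ← Matrix.mul_assoc U,
      hU2, Matrix.one_mul, hV1]
  have hW2 : (Vᴴ * U)ᴴ * (Vᴴ * U) = 1 := by
    rw [conjTranspose_mul, conjTranspose_conjTranspose, Matrix.mul_assoc, ← Matrix.mul_assoc V,
      hV2, Matrix.one_mul, hU1]
  have fin := aux_ds_sum _ (aux_unitary_ds _ hW1 hW2) (fun i => β i / (1 + f * β i)) α τ ρ
    (by
      intro i j hij
      have h := hb_mono hij
      simp only [Function.comp_apply] at h ⊢
      rw [div_le_div_iff₀ (hpos _) (hpos _)]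
      nlinarith) ha_mono
  refine fin.trans_eq (Finset.sum_congr rfl fun i _ => ?_)
  simp only [Function.comp_apply]
  ring
end

section
/- Let N_T, N_R, N_U be positive natural numbers, f ≥ 0, and ψ₁, ψ₂ > 0 real numbers. Let H₁ ∈ ℂ^{N_U×N_T} satisfy H₁H₁ᴴ = ψ₁²·I_{N_U} and H₂ ∈ ℂ^{N_R×N_U} satisfy H₂ᴴH₂ = ψ₂²·I_{N_U}. Then tr((f·H₂H₂ᴴ + I_{N_R})⁻¹H₂H₁H₁ᴴH₂ᴴ) = N_U · ψ₁²ψ₂² / (1 + f·ψ₂²). -/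
open Matrix

/-- equality case of the trace bound in Theorem 2: if
`H₁H₁ᴴ = ψ₁²·I` and `H₂ᴴH₂ = ψ₂²·I` then
`tr((f·H₂H₂ᴴ + I)⁻¹H₂H₁H₁ᴴH₂ᴴ) = N_U·ψ₁²ψ₂²/(1 + f·ψ₂²)`. -/
theorem whitened_trace_orthogonal_case (NT NR NU : ℕ)
    (hT : 0 < NT) (hR : 0 < NR) (hU : 0 < NU)
    (f ψ₁ ψ₂ : ℝ) (hf : 0 ≤ f) (hψ₁ : 0 < ψ₁) (hψ₂ : 0 < ψ₂)
    (H₁ : Matrix (Fin NU) (Fin NT) ℂ) (H₂ : Matrix (Fin NR) (Fin NU) ℂ)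
    (hH₁ : H₁ * H₁ᴴ = ((ψ₁ ^ 2 : ℝ) : ℂ) • (1 : Matrix (Fin NU) (Fin NU) ℂ))
    (hH₂ : H₂ᴴ * H₂ = ((ψ₂ ^ 2 : ℝ) : ℂ) • (1 : Matrix (Fin NU) (Fin NU) ℂ)) :
    ((((f : ℂ) • (H₂ * H₂ᴴ) + 1)⁻¹ * H₂ * H₁ * H₁ᴴ * H₂ᴴ).trace) =
      (((NU : ℝ) * (ψ₁ ^ 2 * ψ₂ ^ 2 / (1 + f * ψ₂ ^ 2)) : ℝ) : ℂ) := by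
  have hc : (1 + (f : ℂ) * (ψ₂ : ℂ) ^ 2) ≠ 0 := by
    have h : (1 + f * ψ₂ ^ 2 : ℝ) ≠ 0 := by positivity
    exact_mod_cast h
  have hAH : ((f : ℂ) • (H₂ * H₂ᴴ) + 1) * H₂ = (1 + (f : ℂ) * (ψ₂ : ℂ) ^ 2) • H₂ := by
    rw [Matrix.add_mul, Matrix.smul_mul, Matrix.mul_assoc, hH₂, Matrix.mul_smul, Matrix.mul_one,
      Matrix.one_mul, smul_smul, add_smul, one_smul, add_comm]
    push_cast
    rfl
  have hdet : IsUnit ((f : ℂ) • (H₂ * H₂ᴴ) + 1).det := by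
    rw [add_comm, ← Matrix.smul_mul, Matrix.det_one_add_mul_comm, Matrix.mul_smul, hH₂, smul_smul]
    have h : (1 : Matrix (Fin NU) (Fin NU) ℂ) + ((f : ℂ) * ((ψ₂ ^ 2 : ℝ) : ℂ)) • 1
        = (1 + (f : ℂ) * (ψ₂ : ℂ) ^ 2) • 1 := by
      rw [add_smul, one_smul]
      push_cast
      rfl
    rw [h, Matrix.det_smul, Matrix.det_one, mul_one]
    exact (pow_ne_zero _ hc).isUnit
  have hinv : ((f : ℂ) • (H₂ * H₂ᴴ) + 1)⁻¹ * H₂ = (1 + (f : ℂ) * (ψ₂ : ℂ) ^ 2)⁻¹ • H₂ := by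
    have h := congrArg (fun M => ((f : ℂ) • (H₂ * H₂ᴴ) + 1)⁻¹ * M) hAH
    simp only [Matrix.nonsing_inv_mul_cancel_left _ _ hdet, Matrix.mul_smul] at h
    rw [eq_inv_smul_iff₀ hc]
    exact h.symm
  rw [hinv, Matrix.mul_assoc _ H₁, hH₁, Matrix.mul_smul, Matrix.mul_one, Matrix.smul_mul,
    Matrix.smul_mul, Matrix.trace_smul, Matrix.trace_smul, Matrix.trace_mul_comm, hH₂,
    Matrix.trace_smul, Matrix.trace_one, Fintype.card_fin]
  push_cast
  simp only [smul_eq_mul]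
  field_simp
end

section
/- Let N_T, N_R, N_U be positive natural numbers, f ≥ 0, c > 0, and ψ₁, ψ₂ > 0 real numbers. Let H₁ ∈ ℂ^{N_U×N_T} satisfy H₁H₁ᴴ = ψ₁²·I_{N_U} and H₂ ∈ ℂ^{N_R×N_U} satisfy H₂ᴴH₂ = ψ₂²·I_{N_U}. Then det(I_{N_T} + c·H₁ᴴH₂ᴴ(f·H₂H₂ᴴ + I_{N_R})⁻¹H₂H₁) = (1 + c·ψ₁²ψ₂²/(1 + f·ψ₂²))^{N_U}; equivalently, the end-to-end capacity equals N_U · log₂(1 + c·ψ₁²ψ₂²/(1 + f·ψ₂²)), attaining the upper bound of Theorem 2 with K = N_U. -/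
open Matrix

/-- equality case of Theorem 2: if `H₁H₁ᴴ = ψ₁²·I` and
`H₂ᴴH₂ = ψ₂²·I` then
`det(I + c·H₁ᴴH₂ᴴ(f·H₂H₂ᴴ + I)⁻¹H₂H₁) = (1 + c·ψ₁²ψ₂²/(1 + f·ψ₂²))^{N_U}`;
equivalently, the end-to-end capacity equals
`N_U·log₂(1 + c·ψ₁²ψ₂²/(1 + f·ψ₂²))`. -/
theorem relay_capacity_orthogonal_case (NT NR NU : ℕ)
    (hT : 0 < NT) (hR : 0 < NR) (hU : 0 < NU)
    (f c ψ₁ ψ₂ : ℝ) (hf : 0 ≤ f) (hc : 0 < c) (hψ₁ : 0 < ψ₁) (hψ₂ : 0 < ψ₂)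
    (H₁ : Matrix (Fin NU) (Fin NT) ℂ) (H₂ : Matrix (Fin NR) (Fin NU) ℂ)
    (hH₁ : H₁ * H₁ᴴ = ((ψ₁ ^ 2 : ℝ) : ℂ) • (1 : Matrix (Fin NU) (Fin NU) ℂ))
    (hH₂ : H₂ᴴ * H₂ = ((ψ₂ ^ 2 : ℝ) : ℂ) • (1 : Matrix (Fin NU) (Fin NU) ℂ)) :
    (1 + (c : ℂ) •
        (H₁ᴴ * H₂ᴴ * ((f : ℂ) • (H₂ * H₂ᴴ) + 1)⁻¹ * H₂ * H₁)).det =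
      (((1 + c * (ψ₁ ^ 2 * ψ₂ ^ 2) / (1 + f * ψ₂ ^ 2) : ℝ)) : ℂ) ^ NU ∧
    Real.logb 2
        ((1 + (c : ℂ) •
          (H₁ᴴ * H₂ᴴ * ((f : ℂ) • (H₂ * H₂ᴴ) + 1)⁻¹ * H₂ * H₁)).det).re =
      (NU : ℝ) * Real.logb 2 (1 + c * (ψ₁ ^ 2 * ψ₂ ^ 2) / (1 + f * ψ₂ ^ 2)) := by
  have hs : (0 : ℝ) < 1 + f * ψ₂ ^ 2 := by positivity
  have hsC : ((1 + f * ψ₂ ^ 2 : ℝ) : ℂ) ≠ 0 := by exact_mod_cast hs.ne'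
  have hAdet : ((f : ℂ) • (H₂ * H₂ᴴ) + 1).det = ((1 + f * ψ₂ ^ 2 : ℝ) : ℂ) ^ NU := by
    rw [add_comm, ← Matrix.smul_mul, Matrix.det_one_add_mul_comm, Matrix.mul_smul, hH₂, smul_smul]
    have : (1 : Matrix (Fin NU) (Fin NU) ℂ) + ((f : ℂ) * ((ψ₂ ^ 2 : ℝ) : ℂ)) • 1
        = ((1 + f * ψ₂ ^ 2 : ℝ) : ℂ) • 1 := by
      push_cast
      rw [add_smul, one_smul]
    rw [this, Matrix.det_smul]
    simp
  have hAu : IsUnit ((f : ℂ) • (H₂ * H₂ᴴ) + 1).det := by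
    rw [hAdet]
    exact (pow_ne_zero _ hsC).isUnit
  have hAH : ((f : ℂ) • (H₂ * H₂ᴴ) + 1) * H₂ = ((1 + f * ψ₂ ^ 2 : ℝ) : ℂ) • H₂ := by
    rw [Matrix.add_mul, Matrix.smul_mul, Matrix.mul_assoc, hH₂, Matrix.mul_smul, Matrix.mul_one,
      Matrix.one_mul, smul_smul]
    push_cast
    rw [add_smul, one_smul, add_comm]
  have hinv : ((f : ℂ) • (H₂ * H₂ᴴ) + 1)⁻¹ * H₂ = ((1 + f * ψ₂ ^ 2 : ℝ) : ℂ)⁻¹ • H₂ := by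
    have h := Matrix.nonsing_inv_mul_cancel_left _ H₂ hAu
    rw [hAH, Matrix.mul_smul] at h
    rw [eq_inv_smul_iff₀ hsC]
    exact h
  have hM : H₁ᴴ * H₂ᴴ * ((f : ℂ) • (H₂ * H₂ᴴ) + 1)⁻¹ * H₂ * H₁
      = (((1 + f * ψ₂ ^ 2 : ℝ) : ℂ)⁻¹ * ((ψ₂ ^ 2 : ℝ) : ℂ)) • (H₁ᴴ * H₁) := by
    rw [Matrix.mul_assoc (H₁ᴴ * H₂ᴴ), hinv, Matrix.mul_smul, Matrix.mul_assoc H₁ᴴ, hH₂,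
      Matrix.mul_smul, Matrix.mul_one, smul_smul, Matrix.smul_mul]
  have hdet : (1 + (c : ℂ) •
        (H₁ᴴ * H₂ᴴ * ((f : ℂ) • (H₂ * H₂ᴴ) + 1)⁻¹ * H₂ * H₁)).det =
      (((1 + c * (ψ₁ ^ 2 * ψ₂ ^ 2) / (1 + f * ψ₂ ^ 2) : ℝ)) : ℂ) ^ NU := by
    rw [hM, smul_smul, ← Matrix.smul_mul, Matrix.det_one_add_mul_comm, Matrix.mul_smul, hH₁,
      smul_smul]
    nth_rewrite 1 [← one_smul ℂ (1 : Matrix (Fin NU) (Fin NU) ℂ)]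
    rw [← add_smul, Matrix.det_smul, Matrix.det_one, mul_one, Fintype.card_fin]
    congr 1
    push_cast
    rw [div_eq_mul_inv]
    ring
  refine ⟨hdet, ?_⟩
  rw [hdet, ← Complex.ofReal_pow, Complex.ofReal_re, Real.logb_pow]
end
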